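/- arXiv:1808.05459 — 2 statements merged into one kernel-verified Lean document; each statement's English description precedes it below -/
import Mathlib

section
/- The stack-sorting operator S is TOTO-definable. Explicitly, for every n, every permutation σ of {1,…,n} and all i, j in {1,…,n}: S(σ)⁻¹(σ(i)) < S(σ)⁻¹(σ(j)) if and only if either (i < j and (σ(i) < σ(j) or there exists z with i < z < j and σ(i) < σ(z))), or (j < i and σ(i) < σ(j) and there is no z with j < z < i and σ(j) < σ(z)). -/
open FirstOrder

/-- Relation symbols of the language `L2` (TOTO): two binary relation symbols `<P` and `<V`. -/
inductive TwoOrderRel : ℕ → Type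
  | ltP : TwoOrderRel 2
  | ltV : TwoOrderRel 2

/-- The first-order language `L2` with exactly two binary relation symbols `<P` and `<V`. -/
def L2 : FirstOrder.Language := ⟨fun _ => Empty, TwoOrderRel⟩

/-- The `L2`-structure `M_σ` associated to a permutation `σ` of `{1,…,n}`:
the domain is `Fin n`, `i <P j` is interpreted as `i < j`, and `i <V j` as `σ i < σ j`. -/
def permStruc2 {n : ℕ} (σ : Equiv.Perm (Fin n)) : L2.Structure (Fin n) where
  funMap := fun {_} f _ => Empty.elim f
  RelMap
    | .ltP => fun x => x 0 < x 1
    | .ltV => fun x => σ (x 0) < σ (x 1)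

/-- Satisfaction of an `L2`-sentence in the structure `M_σ`. -/
def Sat2 {n : ℕ} (σ : Equiv.Perm (Fin n)) (φ : L2.Sentence) : Prop :=
  letI := permStruc2 σ
  (Fin n) ⊨ φ

/-- Realization in `M_σ` of an `L2`-formula with free variables indexed by `α`,
under the assignment `v`. -/
def Real2 {n : ℕ} {α : Type} (σ : Equiv.Perm (Fin n)) (φ : L2.Formula α)
    (v : α → Fin n) : Prop :=
  letI := permStruc2 σ
  φ.Realize v

/-- Stack sorting on lists of (distinct) naturals, with fuel (the fuel `l.length` used in
`stackSort` always suffices): `S([]) = []` and `S(α·m·β) = S(α)·S(β)·m` where `m` is the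
maximum entry. -/
def stackSortFuel : ℕ → List ℕ → List ℕ
  | 0, _ => []
  | fuel + 1, l =>
    if l = [] then []
    else
      let m := l.foldr max 0
      let i := l.idxOf m
      stackSortFuel fuel (l.take i) ++ stackSortFuel fuel (l.drop (i + 1)) ++ [m]

/-- The stack-sorting operator on lists of distinct naturals. -/
def stackSort (l : List ℕ) : List ℕ := stackSortFuel l.length l

/-- The one-line word of a permutation `σ` of `Fin n`. -/
def word {n : ℕ} (σ : Equiv.Perm (Fin n)) : List ℕ := List.ofFn fun i => (σ i : ℕ)

/-- The position (`T(σ)⁻¹(σ(i))`) of the value `σ i` in the output of the sorting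
operator `sortOp` applied to the one-line word of `σ`. -/
def outRank {n : ℕ} (sortOp : List ℕ → List ℕ) (σ : Equiv.Perm (Fin n)) (i : Fin n) : ℕ :=
  (sortOp (word σ)).idxOf (σ i : ℕ)

/-- A sorting operator, given as a map on one-line words, is TOTO-definable if some
`L2`-formula `φ(x,y)` defines the new positional order:
`T(σ)⁻¹(σ(i)) < T(σ)⁻¹(σ(j))` iff `φ(i,j)` holds in `M_σ`. -/
def ListOpTOTODef (sortOp : List ℕ → List ℕ) : Prop :=
  ∃ φ : L2.Formula (Fin 2), ∀ (n : ℕ) (σ : Equiv.Perm (Fin n)) (i j : Fin n),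
    outRank sortOp σ i < outRank sortOp σ j ↔ Real2 σ φ ![i, j]

theorem foldr_max_ge (l : List ℕ) : ∀ x ∈ l, x ≤ l.foldr max 0 := by
  induction l with
  | nil => simp
  | cons a t ih =>
    intro x hx
    rcases List.mem_cons.1 hx with rfl | h
    · simp
    · have := ih x h
      simp only [List.foldr_cons]; omega

theorem foldr_max_mem (l : List ℕ) (h : l ≠ []) : l.foldr max 0 ∈ l := by
  induction l with
  | nil => simp at h
  | cons a t ih =>
    by_cases ht : t = []
    · subst ht; simp
    · have := ih ht
      simp only [List.foldr_cons]
      rcases le_total a (t.foldr max 0) with h1 | h1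
      · rw [max_eq_right h1]; exact List.mem_cons_of_mem _ this
      · rw [max_eq_left h1]; simp

theorem list_split (l : List ℕ) (m : ℕ) (h : m ∈ l) :
    l = l.take (l.idxOf m) ++ m :: l.drop (l.idxOf m + 1) := by
  have hk := List.idxOf_lt_length_of_mem h
  conv_lhs => rw [← List.take_append_drop (l.idxOf m) l, List.drop_eq_getElem_cons hk,
    List.getElem_idxOf hk]

theorem stackSortFuel_perm (f : ℕ) : ∀ l : List ℕ, l.length ≤ f →
    (stackSortFuel f l).Perm l := by
  induction f with
  | zero => intro l h; have : l = [] := by simpa using h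
            subst this; simp [stackSortFuel]
  | succ f ih =>
    intro l h
    by_cases hl : l = []
    · subst hl; simp [stackSortFuel]
    · have hm := foldr_max_mem l hl
      simp only [stackSortFuel, hl, if_false]
      generalize l.foldr max 0 = m at *
      have hk := List.idxOf_lt_length_of_mem hm
      have h1 := ih (l.take (l.idxOf m)) (by simp; omega)
      have h2 := ih (l.drop (l.idxOf m + 1)) (by simp; omega)
      conv_rhs => rw [list_split l m hm]
      rw [List.append_assoc]
      refine h1.append ?_
      exact (h2.append_right [m]).trans (List.perm_append_singleton _ _)

theorem stackSortFuel_order (f : ℕ) : ∀ l : List ℕ, l.length ≤ f → l.Nodup →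
    ∀ (a b : ℕ) (hab : a < b) (hb : b < l.length),
      (stackSortFuel f l).idxOf l[a] < (stackSortFuel f l).idxOf l[b] ↔
        (l[a] < l[b] ∨ ∃ c, ∃ _ : a < c, ∃ _ : c < b, l[a] < l[c]) := by
  induction f with
  | zero => intro l h _ a b hab hb; omega
  | succ f ih =>
    intro l h hnd a b hab hb
    have hl : l ≠ [] := by rintro rfl; simp at hb
    have hm := foldr_max_mem l hl
    have hge := foldr_max_ge l
    simp only [stackSortFuel, hl, if_false]
    generalize l.foldr max 0 = m at *
    have hk := List.idxOf_lt_length_of_mem hm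
    have hkm := List.getElem_idxOf hk
    generalize l.idxOf m = k at *
    have p1 := stackSortFuel_perm f (l.take k) (by simp; omega)
    have p2 := stackSortFuel_perm f (l.drop (k + 1)) (by simp; omega)
    have ih1 := ih (l.take k) (by simp; omega) (hnd.sublist (List.take_sublist _ _))
    have ih2 := ih (l.drop (k + 1)) (by simp; omega) (hnd.sublist (List.drop_sublist _ _))
    generalize stackSortFuel f (l.take k) = A at *
    generalize stackSortFuel f (l.drop (k + 1)) = B at *
    have inj : ∀ (c d : ℕ) (hc : c < l.length) (hd : d < l.length), l[c] = l[d] → c = d :=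
      fun c d hc hd e => (hnd.getElem_inj_iff).1 e
    have memA : ∀ (c : ℕ) (hc : c < l.length), l[c] ∈ A ↔ c < k := by
      intro c hc
      rw [p1.mem_iff, List.mem_take_iff_getElem]
      constructor
      · rintro ⟨d, hd, e⟩
        have := inj _ _ _ _ e
        omega
      · intro h; exact ⟨c, by omega, rfl⟩
    have memB : ∀ (c : ℕ) (hc : c < l.length), l[c] ∈ B ↔ k < c := by
      intro c hc
      rw [p2.mem_iff, List.mem_drop_iff_getElem]
      constructor
      · rintro ⟨d, hd, e⟩
        have := inj _ _ _ _ e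
        omega
      · intro h; exact ⟨c - (k+1), by omega, by congr 1; omega⟩
    have hlt : ∀ (c : ℕ) (hc : c < l.length), c ≠ k → l[c] < m := by
      intro c hc hne
      refine lt_of_le_of_ne (hge _ (List.getElem_mem _)) ?_
      rintro e
      exact hne (inj _ _ hc hk (e.trans hkm.symm))
    have xA : ∀ (c : ℕ) (hc : c < l.length), c < k → 
        (A ++ B ++ [m]).idxOf l[c] = A.idxOf l[c] ∧ A.idxOf l[c] < A.length := by
      intro c hc h
      have h1 := (memA c hc).2 h
      refine ⟨?_, List.idxOf_lt_length_of_mem h1⟩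
      rw [List.append_assoc, List.idxOf_append_of_mem h1]
    have xB : ∀ (c : ℕ) (hc : c < l.length), k < c → 
        (A ++ B ++ [m]).idxOf l[c] = A.length + B.idxOf l[c] ∧ B.idxOf l[c] < B.length := by
      intro c hc h
      have h1 := (memB c hc).2 h
      have h2 : l[c] ∉ A := fun hmem => by have := (memA c hc).1 hmem; omega
      refine ⟨?_, List.idxOf_lt_length_of_mem h1⟩
      rw [List.append_assoc, List.idxOf_append_of_notMem h2, List.idxOf_append_of_mem h1]
    have xk : (A ++ B ++ [m]).idxOf l[k] = A.length + B.length := by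
      have h1 : l[k] ∉ A := fun hmem => by have := (memA k hk).1 hmem; omega
      have h2 : l[k] ∉ B := fun hmem => by have := (memB k hk).1 hmem; omega
      rw [List.append_assoc, List.idxOf_append_of_notMem h1, List.idxOf_append_of_notMem h2, hkm]
      simp
    have ha : a < l.length := by omega
    rcases lt_trichotomy b k with hbk | rfl | hbk
    · rw [(xA a ha (by omega)).1, (xA b hb hbk).1]
      have := ih1 a b hab (by simp; omega)
      simpa only [List.getElem_take] using this
    · have h1 := xA a ha hab
      have h2 := hlt a ha (by omega)
      rw [h1.1, xk]
      constructor
      · intro _; left; omega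
      · intro _; omega
    · have h3 := xB b hb hbk
      rcases lt_trichotomy a k with hak | rfl | hak
      · have h1 := xA a ha hak
        have h2 := hlt a ha (by omega)
        constructor
        · intro _; right; exact ⟨k, hak, hbk, by omega⟩
        · intro _; omega
      · constructor
        · intro _; omega
        · rintro (h | ⟨c, h1, h2, h⟩)
          · have := hlt b hb (by omega); omega
          · have := hlt c (by omega) (by omega); omega
      · rw [(xB a ha hak).1, h3.1]
        have := ih2 (a - (k+1)) (b - (k+1)) (by omega) (by simp; omega)
        simp only [List.getElem_drop] at this
        have ea : k + 1 + (a - (k+1)) = a := by omega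
        have eb : k + 1 + (b - (k+1)) = b := by omega
        simp only [ea, eb] at this
        rw [Nat.add_lt_add_iff_left, this]
        refine or_congr Iff.rfl ⟨?_, ?_⟩
        · rintro ⟨c, h1, h2, h⟩
          exact ⟨k + 1 + c, by omega, by omega, h⟩
        · rintro ⟨c, h1, h2, h⟩
          refine ⟨c - (k+1), by omega, by omega, ?_⟩
          have ec : k + 1 + (c - (k+1)) = c := by omega
          simpa only [ec] using h

theorem stackSort_lt {n : ℕ} (σ : Equiv.Perm (Fin n)) (i j : Fin n) (hij : i < j) :
    outRank stackSort σ i < outRank stackSort σ j ↔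
      (σ i < σ j ∨ ∃ z : Fin n, i < z ∧ z < j ∧ σ i < σ z) := by
  have hnd : (word σ).Nodup := by
    unfold word
    rw [List.nodup_ofFn]
    exact Fin.val_injective.comp σ.injective
  have := stackSortFuel_order _ (word σ) le_rfl hnd i j hij (by simp [word])
  simp only [word, List.getElem_ofFn, Fin.eta] at this
  unfold outRank stackSort word
  rw [this]
  refine or_congr Fin.lt_def.symm ⟨?_, ?_⟩
  · rintro ⟨c, h1, h2, h⟩
    exact ⟨⟨c, by omega⟩, h1, h2, h⟩
  · rintro ⟨z, h1, h2, h⟩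
    exact ⟨z, h1, h2, h⟩

theorem outRank_inj {n : ℕ} (σ : Equiv.Perm (Fin n)) (i j : Fin n)
    (h : outRank stackSort σ i = outRank stackSort σ j) : i = j := by
  unfold outRank at h
  have hi : (σ i : ℕ) ∈ stackSort (word σ) := by
    unfold stackSort
    rw [(stackSortFuel_perm _ _ le_rfl).mem_iff]
    simp [word, List.mem_ofFn]
  have := (List.idxOf_inj hi).1 h
  exact σ.injective (Fin.val_injective this)

theorem stackSort_explicit (n : ℕ) (σ : Equiv.Perm (Fin n)) (i j : Fin n) :
    outRank stackSort σ i < outRank stackSort σ j ↔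
      ((i < j ∧ (σ i < σ j ∨ ∃ z : Fin n, i < z ∧ z < j ∧ σ i < σ z)) ∨
        (j < i ∧ σ i < σ j ∧ ¬ ∃ z : Fin n, j < z ∧ z < i ∧ σ j < σ z)) := by
  rcases lt_trichotomy i j with h | rfl | h
  · rw [stackSort_lt σ i j h]
    simp [h, h.not_gt]
  · simp
  · have h1 := stackSort_lt σ j i h
    have h2 : outRank stackSort σ i ≠ outRank stackSort σ j := fun e =>
      h.ne' (outRank_inj σ i j e)
    have h3 : outRank stackSort σ i < outRank stackSort σ j ↔
        ¬ (outRank stackSort σ j < outRank stackSort σ i) := by omega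
    have h4 : σ i ≠ σ j := fun e => h.ne' (σ.injective e)
    have h5 : σ i < σ j ↔ ¬ (σ j < σ i) := by
      rw [not_lt]; exact ⟨le_of_lt, fun e => lt_of_le_of_ne e h4⟩
    rw [h3, h1, h5]
    simp only [h, h.not_gt, true_and, false_and, false_or, not_or]

/-- Atomic formula `t <P u`. -/
def fP {k : ℕ} (t u : L2.Term (Fin 2 ⊕ Fin k)) : L2.BoundedFormula (Fin 2) k :=
  Language.Relations.boundedFormula₂ (L := L2) (TwoOrderRel.ltP : L2.Relations 2) t u

/-- Atomic formula `t <V u`. -/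
def fV {k : ℕ} (t u : L2.Term (Fin 2 ⊕ Fin k)) : L2.BoundedFormula (Fin 2) k :=
  Language.Relations.boundedFormula₂ (L := L2) (TwoOrderRel.ltV : L2.Relations 2) t u

/-- A free variable as a term. -/
def fx {k : ℕ} (i : Fin 2) : L2.Term (Fin 2 ⊕ Fin k) := Language.Term.var (Sum.inl i)

/-- The bound variable as a term. -/
def fz : L2.Term (Fin 2 ⊕ Fin 1) := Language.Term.var (Sum.inr 0)

/-- There is a point positioned between `a` and `b` with value above `a`. -/
def fBetween (a b : Fin 2) : L2.BoundedFormula (Fin 2) 0 :=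
  (fP (fx a) fz ⊓ (fP fz (fx b) ⊓ fV (fx a) fz)).ex

/-- The defining formula. -/
def stackFormula : L2.Formula (Fin 2) :=
  (fP (fx 0) (fx 1) ⊓ (fV (fx 0) (fx 1) ⊔ fBetween 0 1)) ⊔
    (fP (fx 1) (fx 0) ⊓ (fV (fx 0) (fx 1) ⊓ (fBetween 1 0).not))

theorem realize_fP {n k : ℕ} (σ : Equiv.Perm (Fin n)) (t u : L2.Term (Fin 2 ⊕ Fin k))
    (v : Fin 2 → Fin n) (xs : Fin k → Fin n) :
    letI := permStruc2 σ
    (fP t u).Realize v xs ↔ t.realize (Sum.elim v xs) < u.realize (Sum.elim v xs) := by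
  letI := permStruc2 σ
  exact Language.BoundedFormula.realize_rel₂

theorem realize_fV {n k : ℕ} (σ : Equiv.Perm (Fin n)) (t u : L2.Term (Fin 2 ⊕ Fin k))
    (v : Fin 2 → Fin n) (xs : Fin k → Fin n) :
    letI := permStruc2 σ
    (fV t u).Realize v xs ↔ σ (t.realize (Sum.elim v xs)) < σ (u.realize (Sum.elim v xs)) := by
  letI := permStruc2 σ
  exact Language.BoundedFormula.realize_rel₂

theorem realize_stackFormula {n : ℕ} (σ : Equiv.Perm (Fin n)) (i j : Fin n) :
    Real2 σ stackFormula ![i, j] ↔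
      ((i < j ∧ (σ i < σ j ∨ ∃ z : Fin n, i < z ∧ z < j ∧ σ i < σ z)) ∨
        (j < i ∧ σ i < σ j ∧ ¬ ∃ z : Fin n, j < z ∧ z < i ∧ σ j < σ z)) := by
  letI := permStruc2 σ
  unfold Real2 stackFormula fBetween Language.Formula.Realize
  simp only [Language.BoundedFormula.realize_sup, Language.BoundedFormula.realize_inf,
    Language.BoundedFormula.realize_not, Language.BoundedFormula.realize_ex,
    realize_fP, realize_fV, fx, fz, Language.Term.realize_var, Sum.elim_inl, Sum.elim_inr]
  rfl

theorem stackSort_TOTO_definable :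
    ListOpTOTODef stackSort ∧
      ∀ (n : ℕ) (σ : Equiv.Perm (Fin n)) (i j : Fin n),
        outRank stackSort σ i < outRank stackSort σ j ↔
          ((i < j ∧ (σ i < σ j ∨ ∃ z : Fin n, i < z ∧ z < j ∧ σ i < σ z)) ∨
            (j < i ∧ σ i < σ j ∧ ¬ ∃ z : Fin n, j < z ∧ z < i ∧ σ j < σ z)) := by
  refine ⟨⟨stackFormula, fun n σ i j => ?_⟩, stackSort_explicit⟩
  rw [stackSort_explicit, realize_stackFormula]
end

section
/- The bubble-sort operator B and the queue-with-bypass operator Q are both TOTO-definable; consequently, for every finite composition F of the operators S, B and Q, the set of permutations σ with F(σ) equal to the identity permutation is TOTO-definable. -/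
open FirstOrder

/-- The type of all permutations of all finite sizes. -/
def Perms := Σ n : ℕ, Equiv.Perm (Fin n)

/-- A set of permutations is TOTO-definable if some `L2`-sentence defines it. -/
def TOTODef (E : Set Perms) : Prop :=
  ∃ φ : L2.Sentence, ∀ (n : ℕ) (σ : Equiv.Perm (Fin n)), Sat2 σ φ ↔ (⟨n, σ⟩ : Perms) ∈ E

/-- Bubble sort on lists of (distinct) naturals, with fuel (the fuel `l.length` used in
`bubbleSort` always suffices): `B([]) = []` and `B(α·m·β) = B(α)·β·m` where `m` is the
maximum entry. -/
def bubbleSortFuel : ℕ → List ℕ → List ℕ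
  | 0, _ => []
  | fuel + 1, l =>
    if l = [] then []
    else
      let m := l.foldr max 0
      let i := l.idxOf m
      bubbleSortFuel fuel (l.take i) ++ l.drop (i + 1) ++ [m]

/-- The bubble-sort operator on lists of distinct naturals. -/
def bubbleSort (l : List ℕ) : List ℕ := bubbleSortFuel l.length l

/-- Sorting with a queue and bypass: `queueSortAux input queue` processes the input from
left to right.  When `a` is processed, the elements of the queue smaller than `a` (an
initial segment of the queue, the queue content being kept increasing) are removed from
the queue and appended to the output; then `a` is appended to the queue if the queue has
become empty, and appended to the output otherwise.  At the end, the remaining queue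
content is appended to the output. -/
def queueSortAux : List ℕ → List ℕ → List ℕ
  | [], q => q
  | a :: rest, q =>
    let out := q.takeWhile (· < a)
    let q' := q.dropWhile (· < a)
    if q' = [] then out ++ queueSortAux rest [a]
    else out ++ [a] ++ queueSortAux rest q'

/-- The queue-with-bypass sorting operator on lists of distinct naturals. -/
def queueSort (l : List ℕ) : List ℕ := queueSortAux l []


/-- `x` occurs before `y` in `l`. -/
def bef : List ℕ → ℕ → ℕ → Prop
  | [], _, _ => False
  | a :: l, x, y => (x = a ∧ y ∈ l) ∨ bef l x y

theorem bef_mem {l : List ℕ} {x y : ℕ} (h : bef l x y) : x ∈ l ∧ y ∈ l := by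
  induction l with
  | nil => exact h.elim
  | cons a l ih =>
    rcases h with ⟨rfl, h⟩ | h
    · simp [h]
    · simp [ih h]

theorem bef_append (l l' : List ℕ) (x y : ℕ) :
    bef (l ++ l') x y ↔ bef l x y ∨ (x ∈ l ∧ y ∈ l') ∨ bef l' x y := by
  induction l with
  | nil => simp [bef]
  | cons a l ih => simp only [List.cons_append, bef, ih, List.mem_append, List.mem_cons]; tauto

theorem bef_idxOf {l : List ℕ} (hl : l.Nodup) {x y : ℕ} (hx : x ∈ l) (hy : y ∈ l) :
    l.idxOf x < l.idxOf y ↔ bef l x y := by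
  induction l with
  | nil => simp at hx
  | cons a l ih =>
    have hn := List.nodup_cons.1 hl
    have hm := @bef_mem l x y
    by_cases h1 : x = a <;> by_cases h2 : y = a
    · subst h1; subst h2; simp [bef]; grind
    · subst h1; rw [List.idxOf_cons_self, List.idxOf_cons_ne _ (Ne.symm h2)]
      simp [bef]; grind
    · subst h2; rw [List.idxOf_cons_self, List.idxOf_cons_ne _ (Ne.symm h1)]
      simp [bef]; grind
    · rw [List.idxOf_cons_ne _ (Ne.symm h1), List.idxOf_cons_ne _ (Ne.symm h2)]
      simp only [List.mem_cons, h1, h2, false_or] at hx hy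
      simp [bef, h1, ih hn.2 hx hy]

theorem bef_asymm {l : List ℕ} (hl : l.Nodup) {x y : ℕ} (h : bef l x y) : ¬ bef l y x := by
  have hm := bef_mem h
  rw [← bef_idxOf hl hm.1 hm.2] at h
  rw [← bef_idxOf hl hm.2 hm.1]; omega

theorem bef_total {l : List ℕ} {x y : ℕ} (hx : x ∈ l) (hy : y ∈ l) :
    bef l x y ∨ x = y ∨ bef l y x := by
  induction l with
  | nil => simp at hx
  | cons a l ih => simp only [bef, List.mem_cons] at *; grind

theorem pairwise_bef {R : ℕ → ℕ → Prop} {l : List ℕ} :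
    l.Pairwise R ↔ ∀ x y, bef l x y → R x y := by
  induction l with
  | nil => simp [bef]
  | cons a l ih => simp only [List.pairwise_cons, ih, bef]; grind

/-- decomposition at the maximum -/
theorem max_decomp {l : List ℕ} (h : l ≠ []) :
    ∃ α m β, l = α ++ m :: β ∧ m = l.foldr max 0 ∧ l.take (l.idxOf m) = α ∧
      l.drop (l.idxOf m + 1) = β ∧ (∀ z ∈ α, z < m) ∧ ∀ z ∈ β, z ≤ m := by
  have hle : ∀ l : List ℕ, ∀ z ∈ l, z ≤ l.foldr max 0 := by
    intro l
    induction l with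
    | nil => simp
    | cons a l ih => simp only [List.mem_cons, List.foldr_cons]; grind
  have hmem : ∀ l : List ℕ, l ≠ [] → l.foldr max 0 ∈ l := by
    intro l
    induction l with
    | nil => simp
    | cons a l ih =>
      intro _
      by_cases hl : l = []
      · simp [hl]
      · have := ih hl
        simp only [List.mem_cons, List.foldr_cons]
        rcases max_choice a (l.foldr max 0) with h | h <;> rw [h] <;> simp [this]
  obtain ⟨α, β, h1, h2⟩ := List.eq_append_cons_of_mem (hmem l h)
  have hi : l.idxOf (l.foldr max 0) = α.length := by
    generalize l.foldr max 0 = m at *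
    rw [h1, List.idxOf_append_of_notMem h2]; simp
  refine ⟨α, l.foldr max 0, β, h1, rfl, ?_, ?_, ?_, ?_⟩
  · rw [hi]; generalize l.foldr max 0 = m at *; rw [h1]; simp
  · rw [hi]; generalize l.foldr max 0 = m at *; rw [h1]; simp
  · intro z hz
    have : z ∈ l := by rw [h1]; simp [hz]
    exact lt_of_le_of_ne (hle l z this) (fun e => h2 (e ▸ hz))
  · intro z hz
    have : z ∈ l := by rw [h1]; simp [hz]
    exact hle l z this

/-- The order of `T l` is the order of `l`, with the pairs in `Sw` exchanged. -/
def Chr (Sw : List ℕ → ℕ → ℕ → Prop) (T : List ℕ → List ℕ) : Prop :=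
  ∀ l : List ℕ, l.Nodup → (T l).Perm l ∧ ∀ x ∈ l, ∀ y ∈ l,
    (bef (T l) x y ↔ (bef l x y ∧ ¬ Sw l x y) ∨ (bef l y x ∧ Sw l y x))

def SwB (l : List ℕ) (x y : ℕ) : Prop := ∀ z, (bef l z y ∨ z = y) → z ≤ x
def SwS (l : List ℕ) (x y : ℕ) : Prop := ∀ z, bef l x z → (bef l z y ∨ z = y) → z ≤ x

/-- facts about a decomposed list -/
theorem bef_decomp {α β : List ℕ} {m : ℕ} (x y : ℕ) :
    bef (α ++ m :: β) x y ↔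
      bef α x y ∨ (x ∈ α ∧ (y = m ∨ y ∈ β)) ∨ (x = m ∧ y ∈ β) ∨ bef β x y := by
  rw [bef_append]; simp [bef]

theorem chrB_aux (f : ℕ) : ∀ l : List ℕ, l.length ≤ f → l.Nodup →
    (bubbleSortFuel f l).Perm l ∧ ∀ x ∈ l, ∀ y ∈ l,
    (bef (bubbleSortFuel f l) x y ↔ (bef l x y ∧ ¬ SwB l x y) ∨ (bef l y x ∧ SwB l y x)) := by
  induction f with
  | zero =>
    intro l hl _
    have : l = [] := by simpa using hl
    subst this; simp [bubbleSortFuel]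
  | succ f ih =>
    intro l hl hn
    by_cases h0 : l = []
    · subst h0; simp [bubbleSortFuel]
    obtain ⟨α, m, β, e, hm, e1, e2, ha, hb⟩ := max_decomp h0
    have hT : bubbleSortFuel (f+1) l = bubbleSortFuel f α ++ β ++ [m] := by
      rw [bubbleSortFuel, if_neg h0]
      simp only [← hm, e1, e2]
    rw [hT]
    clear hT e1 e2 hm
    subst e
    have hlen : α.length ≤ f := by simp at hl; omega
    have hn' := hn
    rw [List.nodup_append, List.nodup_cons] at hn'
    obtain ⟨hp, hc⟩ := ih α hlen hn'.1
    have hdis : ∀ z ∈ α, z ∉ β := fun z h1 h2 => hn'.2.2 z h1 z (by simp [h2]) rfl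
    have hma : m ∉ α := fun h => lt_irrefl _ (ha m h)
    have hmb := hn'.2.1.1
    have hba := fun x y => @bef_mem α x y
    have hbb := fun x y => @bef_mem β x y
    have hmem : ∀ z, z ∈ bubbleSortFuel f α ↔ z ∈ α := fun z => hp.mem_iff
    have hbp := fun x y => @bef_mem (bubbleSortFuel f α) x y
    refine ⟨?_, ?_⟩
    · rw [List.append_assoc]
      exact hp.append (List.perm_append_singleton m β)
    · intro x hx y hy
      have key : bef (bubbleSortFuel f α ++ β ++ [m]) x y ↔
          bef (bubbleSortFuel f α) x y ∨ (x ∈ α ∧ y ∈ β) ∨ bef β x y ∨ ((x ∈ α ∨ x ∈ β) ∧ y = m) := by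
        rw [bef_append, bef_append]; simp [bef, hmem]; tauto
      rw [key]
      clear key hp ih hl hlen hn h0
      generalize bubbleSortFuel f α = A at *
      have hasymA := fun x y => @bef_asymm α hn'.1 x y
      have hasymB := fun x y => @bef_asymm β hn'.2.1.2 x y
      clear hn'
      have sw1 : ∀ x y, y ∈ α → (SwB (α ++ m :: β) x y ↔ SwB α x y) := by
        intro x y hy
        clear hc hbp hmem
        simp only [SwB, bef_decomp]
        grind
      have sw2 : ∀ x y, y ∈ β → (SwB (α ++ m :: β) x y ↔ m ≤ x) := by
        intro x y hy
        clear hc hbp hmem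
        simp only [SwB, bef_decomp]
        constructor
        · intro h; exact h m (by simp [hy])
        · intro h z hz; grind
      have sw3 : ∀ x, (SwB (α ++ m :: β) x m ↔ m ≤ x) := by
        intro x
        clear hc hbp hmem
        simp only [SwB, bef_decomp]
        constructor
        · intro h; exact h m (by simp)
        · intro h z hz; grind
      simp only [List.mem_append, List.mem_cons] at hx hy
      simp only [bef_decomp]
      rcases hx with hx | rfl | hx <;> rcases hy with hy | rfl | hy
      all_goals grind

theorem chrB : Chr SwB bubbleSort := fun l hl => chrB_aux _ l le_rfl hl

theorem chrS_aux (f : ℕ) : ∀ l : List ℕ, l.length ≤ f → l.Nodup →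
    (stackSortFuel f l).Perm l ∧ ∀ x ∈ l, ∀ y ∈ l,
    (bef (stackSortFuel f l) x y ↔ (bef l x y ∧ ¬ SwS l x y) ∨ (bef l y x ∧ SwS l y x)) := by
  induction f with
  | zero =>
    intro l hl _
    have : l = [] := by simpa using hl
    subst this; simp [stackSortFuel]
  | succ f ih =>
    intro l hl hn
    by_cases h0 : l = []
    · subst h0; simp [stackSortFuel]
    obtain ⟨α, m, β, e, hm, e1, e2, ha, hb⟩ := max_decomp h0
    have hT : stackSortFuel (f+1) l = stackSortFuel f α ++ stackSortFuel f β ++ [m] := by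
      rw [stackSortFuel, if_neg h0]
      simp only [← hm, e1, e2]
    rw [hT]
    clear hT e1 e2 hm
    subst e
    have hlen : α.length ≤ f := by simp at hl; omega
    have hlen' : β.length ≤ f := by simp at hl; omega
    have hn' := hn
    rw [List.nodup_append, List.nodup_cons] at hn'
    obtain ⟨hp, hc⟩ := ih α hlen hn'.1
    obtain ⟨hp', hc'⟩ := ih β hlen' hn'.2.1.2
    have hdis : ∀ z ∈ α, z ∉ β := fun z h1 h2 => hn'.2.2 z h1 z (by simp [h2]) rfl
    have hma : m ∉ α := fun h => lt_irrefl _ (ha m h)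
    have hmb := hn'.2.1.1
    have hba := fun x y => @bef_mem α x y
    have hbb := fun x y => @bef_mem β x y
    have hmem : ∀ z, z ∈ stackSortFuel f α ↔ z ∈ α := fun z => hp.mem_iff
    have hmem' : ∀ z, z ∈ stackSortFuel f β ↔ z ∈ β := fun z => hp'.mem_iff
    have hbp := fun x y => @bef_mem (stackSortFuel f α) x y
    have hbp' := fun x y => @bef_mem (stackSortFuel f β) x y
    refine ⟨?_, ?_⟩
    · rw [List.append_assoc]
      exact hp.append ((hp'.append_right _).trans (List.perm_append_singleton m β))
    · intro x hx y hy
      have key : bef (stackSortFuel f α ++ stackSortFuel f β ++ [m]) x y ↔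
          bef (stackSortFuel f α) x y ∨ (x ∈ α ∧ y ∈ β) ∨ bef (stackSortFuel f β) x y ∨
            ((x ∈ α ∨ x ∈ β) ∧ y = m) := by
        rw [bef_append, bef_append]; simp [bef, hmem, hmem']; tauto
      rw [key]
      clear key hp ih hl hlen hn h0 hp' hlen'
      generalize stackSortFuel f α = A at *
      generalize stackSortFuel f β = A' at *
      have hasymA := fun x y => @bef_asymm α hn'.1 x y
      have hasymB := fun x y => @bef_asymm β hn'.2.1.2 x y
      clear hn'
      have sw1 : ∀ x y, x ∈ α → y ∈ α → (SwS (α ++ m :: β) x y ↔ SwS α x y) := by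
        intro x y hx hy
        clear hc hbp hmem hc' hbp' hmem'
        simp only [SwS, bef_decomp]
        grind
      have sw2 : ∀ x y, x ∈ α → y ∈ β → ¬ SwS (α ++ m :: β) x y := by
        intro x y hx hy h
        have := h m (by simp [bef_decomp, hx]) (by simp [bef_decomp, hy])
        have := ha x hx
        omega
      have sw3 : ∀ x, x ∈ α → ¬ SwS (α ++ m :: β) x m := by
        intro x hx h
        have := h m (by simp [bef_decomp, hx]) (by simp)
        have := ha x hx
        omega
      have sw4 : ∀ y, y ∈ β → SwS (α ++ m :: β) m y := by
        intro y hy z h1 h2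
        clear hc hbp hmem hc' hbp' hmem'
        rw [bef_decomp] at h1
        grind
      have sw5 : ∀ x y, x ∈ β → y ∈ β → (SwS (α ++ m :: β) x y ↔ SwS β x y) := by
        intro x y hx hy
        clear hc hbp hmem hc' hbp' hmem'
        simp only [SwS, bef_decomp]
        grind
      simp only [List.mem_append, List.mem_cons] at hx hy
      simp only [bef_decomp]
      rcases hx with hx | rfl | hx <;> rcases hy with hy | rfl | hy
      all_goals grind

theorem chrS : Chr SwS stackSort := fun l hl => chrS_aux _ l le_rfl hl

theorem queue_append (α β : List ℕ) (m : ℕ) (ha : ∀ z ∈ α, z < m) :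
    ∀ q : List ℕ, (∀ z ∈ q, z < m) →
      queueSortAux (α ++ m :: β) q = queueSortAux α q ++ queueSortAux β [m] := by
  induction α with
  | nil =>
    intro q hq
    have h1 : q.takeWhile (· < m) = q := List.takeWhile_eq_self_iff.2 (by simpa using hq)
    have h2 : q.dropWhile (· < m) = [] := List.dropWhile_eq_nil_iff.2 (by simpa using hq)
    simp [queueSortAux, h1, h2]
  | cons a α ih =>
    intro q hq
    have ih' := ih (fun z hz => ha z (by simp [hz]))
    simp only [List.cons_append, queueSortAux]
    split_ifs with h
    · rw [ih' [a] (by simpa using ha a (by simp)), List.append_assoc]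
    · rw [ih' _ (fun z hz => hq z ((List.dropWhile_sublist _).subset hz))]
      simp [List.append_assoc]

theorem queue_max (β : List ℕ) (m : ℕ) (hb : ∀ z ∈ β, z ≤ m) :
    queueSortAux β [m] = β ++ [m] := by
  induction β with
  | nil => rfl
  | cons a β ih =>
    have h : ¬ m < a := not_lt.2 (hb a (by simp))
    simp [queueSortAux, List.takeWhile, List.dropWhile, h, ih (fun z hz => hb z (by simp [hz]))]

theorem bubble_eq_queue_aux (f : ℕ) : ∀ l : List ℕ, l.length ≤ f →
    bubbleSortFuel f l = queueSort l := by
  induction f with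
  | zero =>
    intro l hl
    have : l = [] := by simpa using hl
    subst this; rfl
  | succ f ih =>
    intro l hl
    by_cases h0 : l = []
    · subst h0; rfl
    obtain ⟨α, m, β, e, hm, e1, e2, ha, hb⟩ := max_decomp h0
    rw [bubbleSortFuel, if_neg h0]
    simp only [← hm, e1, e2]
    clear e1 e2 hm
    subst e
    rw [ih α (by simp at hl; omega), queueSort, queueSort, queue_append α β m ha [] (by simp),
      queue_max β m hb, List.append_assoc]

theorem queue_eq : queueSort = bubbleSort :=
  funext fun l => (bubble_eq_queue_aux _ l le_rfl).symm

/-- Uniformly definable families of relations. -/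
def D (α : Type) (R : ∀ n : ℕ, Equiv.Perm (Fin n) → (α → Fin n) → Prop) : Prop :=
  ∃ φ : L2.Formula α, ∀ n σ v, R n σ v ↔ Real2 σ φ v

namespace D

theorem not' {α : Type} {R : ∀ n : ℕ, Equiv.Perm (Fin n) → (α → Fin n) → Prop} (h : D α R) :
    D α (fun n σ v => ¬ R n σ v) := by
  obtain ⟨φ, h⟩ := h
  refine ⟨φ.not, fun n σ v => ?_⟩
  exact (not_congr (h n σ v)).trans
    (@Language.Formula.realize_not L2 (Fin n) (permStruc2 σ) α φ v).symm

theorem and' {α : Type} {R R' : ∀ n : ℕ, Equiv.Perm (Fin n) → (α → Fin n) → Prop}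
    (h : D α R) (h' : D α R') : D α (fun n σ v => R n σ v ∧ R' n σ v) := by
  obtain ⟨φ, h⟩ := h
  obtain ⟨ψ, h'⟩ := h'
  refine ⟨φ ⊓ ψ, fun n σ v => ?_⟩
  exact (and_congr (h n σ v) (h' n σ v)).trans
    (@Language.Formula.realize_inf L2 (Fin n) (permStruc2 σ) α φ ψ v).symm

theorem congr' {α : Type} {R R' : ∀ n : ℕ, Equiv.Perm (Fin n) → (α → Fin n) → Prop}
    (h : D α R) (e : ∀ n σ v, R' n σ v ↔ R n σ v) : D α R' := by
  obtain ⟨φ, h⟩ := h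
  exact ⟨φ, fun n σ v => (e n σ v).trans (h n σ v)⟩

theorem or' {α : Type} {R R' : ∀ n : ℕ, Equiv.Perm (Fin n) → (α → Fin n) → Prop}
    (h : D α R) (h' : D α R') : D α (fun n σ v => R n σ v ∨ R' n σ v) :=
  (h.not'.and' h'.not').not'.congr' fun n σ v => by tauto

theorem imp' {α : Type} {R R' : ∀ n : ℕ, Equiv.Perm (Fin n) → (α → Fin n) → Prop}
    (h : D α R) (h' : D α R') : D α (fun n σ v => R n σ v → R' n σ v) :=
  (h.and' h'.not').not'.congr' fun n σ v => by tauto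

theorem ex {α : Type} {R : ∀ n : ℕ, Equiv.Perm (Fin n) → (α → Fin n) → Fin n → Prop}
    (h : D (α ⊕ Unit) (fun n σ v => R n σ (fun a => v (.inl a)) (v (.inr ())))) :
    D α (fun n σ v => ∃ x, R n σ v x) := by
  obtain ⟨φ, h⟩ := h
  refine ⟨φ.iExs Unit, fun n σ v => ?_⟩
  letI := permStruc2 σ
  refine Iff.trans ?_ (Language.Formula.realize_iExs (φ := φ)).symm
  constructor
  · rintro ⟨x, hx⟩
    exact ⟨fun _ => x, (h n σ (Sum.elim v (fun _ => x))).1 hx⟩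
  · rintro ⟨x, hx⟩
    exact ⟨x (), (h n σ (Sum.elim v x)).2 hx⟩

theorem all {α : Type} {R : ∀ n : ℕ, Equiv.Perm (Fin n) → (α → Fin n) → Fin n → Prop}
    (h : D (α ⊕ Unit) (fun n σ v => R n σ (fun a => v (.inl a)) (v (.inr ())))) :
    D α (fun n σ v => ∀ x, R n σ v x) :=
  (ex (R := fun n σ v x => ¬ R n σ v x) h.not').not'.congr' fun n σ v => by simp

theorem ltP {α : Type} (a b : α) : D α (fun _ _ v => v a < v b) := by
  refine ⟨Language.Relations.formula₂ (L := L2) (show L2.Relations 2 from TwoOrderRel.ltP) (.var a) (.var b),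
    fun n σ v => ?_⟩
  letI := permStruc2 σ
  exact (Language.Formula.realize_rel₂ (L := L2) (M := Fin n) (v := v)
    (R := (show L2.Relations 2 from TwoOrderRel.ltP))
    (t₁ := .var a) (t₂ := .var b)).symm

theorem ltV {α : Type} (a b : α) : D α (fun _ σ v => σ (v a) < σ (v b)) := by
  refine ⟨Language.Relations.formula₂ (L := L2) (show L2.Relations 2 from TwoOrderRel.ltV) (.var a) (.var b),
    fun n σ v => ?_⟩
  letI := permStruc2 σ
  exact (Language.Formula.realize_rel₂ (L := L2) (M := Fin n) (v := v)
    (R := (show L2.Relations 2 from TwoOrderRel.ltV))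
    (t₁ := .var a) (t₂ := .var b)).symm

theorem eq' {α : Type} (a b : α) : D α (fun _ _ v => v a = v b) :=
  ((ltP a b).or' (ltP b a)).not'.congr' fun n σ v => by
    rw [not_or, not_lt, not_lt]; exact ⟨fun h => ⟨h.ge, h.le⟩, fun h => le_antisymm h.2 h.1⟩

end D

/-- A definable family of words, each a rearrangement of the one-line word. -/
structure GoodW (w : ∀ n : ℕ, Equiv.Perm (Fin n) → List ℕ) : Prop where
  perm : ∀ n σ, (w n σ).Perm (word σ)
  dfn : ∀ (α : Type) (a b : α), D α (fun n σ v => bef (w n σ) (σ (v a)) (σ (v b)))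

theorem word_nodup {n : ℕ} (σ : Equiv.Perm (Fin n)) : (word σ).Nodup :=
  List.nodup_ofFn.2 fun i j h => σ.injective (Fin.ext h)

theorem mem_word {n : ℕ} (σ : Equiv.Perm (Fin n)) (z : ℕ) :
    z ∈ word σ ↔ ∃ i, (σ i : ℕ) = z := by
  rw [word, List.mem_ofFn]

theorem GoodW.word : GoodW (fun _ σ => word σ) where
  perm _ _ := .refl _
  dfn α a b := (D.ltP a b).congr' fun n σ v => by
    rw [← bef_idxOf (word_nodup σ) ((mem_word σ _).2 ⟨_, rfl⟩) ((mem_word σ _).2 ⟨_, rfl⟩)]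
    have : ∀ i : Fin n, (_root_.word σ).idxOf (σ i : ℕ) = i := by
      intro i
      have hi : (i : ℕ) < (_root_.word σ).length := by simp [_root_.word]
      have := (word_nodup σ).idxOf_getElem i hi
      simpa [_root_.word] using this
    rw [this, this]; rfl

theorem GoodW.bef_mem {w} (hw : GoodW w) {n : ℕ} (σ : Equiv.Perm (Fin n)) {x y : ℕ}
    (h : bef (w n σ) x y) : (∃ i, (σ i : ℕ) = x) ∧ ∃ j, (σ j : ℕ) = y := by
  have := _root_.bef_mem h
  rwa [(hw.perm n σ).mem_iff, (hw.perm n σ).mem_iff, mem_word, mem_word] at this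

theorem GoodW.swB {w} (hw : GoodW w) (α : Type) (a b : α) :
    D α (fun n σ v => SwB (w n σ) (σ (v a)) (σ (v b))) := by
  have : D α (fun n σ v => ∀ k : Fin n,
      (bef (w n σ) (σ k) (σ (v b)) ∨ k = v b) → ¬ σ (v a) < σ k) :=
    D.all (((hw.dfn _ _ _).or' (D.eq' _ (Sum.inl b))).imp' (D.ltV (Sum.inl a) _).not')
  refine this.congr' fun n σ v => ?_
  constructor
  · intro h k hk
    exact not_lt.2 (h (σ k) (hk.imp id (fun e => by rw [e])))
  · intro h z hz
    obtain ⟨k, rfl⟩ : ∃ k, (σ k : ℕ) = z := by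
      rcases hz with hz | rfl
      · exact (hw.bef_mem σ hz).1
      · exact ⟨_, rfl⟩
    exact not_lt.1 (h k (hz.imp id (fun e => σ.injective (Fin.ext e))))

theorem GoodW.swS {w} (hw : GoodW w) (α : Type) (a b : α) :
    D α (fun n σ v => SwS (w n σ) (σ (v a)) (σ (v b))) := by
  have : D α (fun n σ v => ∀ k : Fin n, bef (w n σ) (σ (v a)) (σ k) →
      (bef (w n σ) (σ k) (σ (v b)) ∨ k = v b) → ¬ σ (v a) < σ k) :=
    D.all ((hw.dfn _ (Sum.inl a) _).imp'
      (((hw.dfn _ _ _).or' (D.eq' _ (Sum.inl b))).imp' (D.ltV (Sum.inl a) _).not'))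
  refine this.congr' fun n σ v => ?_
  constructor
  · intro h k hk' hk
    exact not_lt.2 (h (σ k) hk' (hk.imp id (fun e => by rw [e])))
  · intro h z hz' hz
    obtain ⟨k, rfl⟩ : ∃ k, (σ k : ℕ) = z := (hw.bef_mem σ hz').2
    exact not_lt.1 (h k hz' (hz.imp id (fun e => σ.injective (Fin.ext e))))

theorem GoodW.step {w} (hw : GoodW w) {Sw T} (hT : Chr Sw T)
    (hS : ∀ (α : Type) (a b : α), D α (fun n σ v => Sw (w n σ) (σ (v a)) (σ (v b)))) :
    GoodW (fun n σ => T (w n σ)) := by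
  have hnd : ∀ n σ, (w n σ).Nodup := fun n σ => (hw.perm n σ).nodup_iff.2 (word_nodup σ)
  refine ⟨fun n σ => (hT _ (hnd n σ)).1.trans (hw.perm n σ), fun α a b => ?_⟩
  refine (((hw.dfn α a b).and' (hS α a b).not').or' ((hw.dfn α b a).and' (hS α b a))).congr'
    fun n σ v => ?_
  have hm : ∀ i, (σ i : ℕ) ∈ w n σ := fun i =>
    (hw.perm n σ).mem_iff.2 ((mem_word σ _).2 ⟨i, rfl⟩)
  exact (hT _ (hnd n σ)).2 _ (hm _) _ (hm _)

theorem GoodW.op {w} (hw : GoodW w) {T : List ℕ → List ℕ}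
    (h : T = stackSort ∨ T = bubbleSort ∨ T = queueSort) : GoodW (fun n σ => T (w n σ)) := by
  rw [queue_eq, or_self] at h
  rcases h with rfl | rfl
  · exact hw.step chrS hw.swS
  · exact hw.step chrB hw.swB

theorem GoodW.toDef {T : List ℕ → List ℕ} (h : GoodW (fun _ σ => T (_root_.word σ))) :
    ListOpTOTODef T := by
  obtain ⟨φ, hφ⟩ := h.dfn (Fin 2) 0 1
  refine ⟨φ, fun n σ i j => ?_⟩
  rw [← hφ]
  have hm : ∀ i, (σ i : ℕ) ∈ T (_root_.word σ) := fun i =>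
    (h.perm n σ).mem_iff.2 ((mem_word σ _).2 ⟨i, rfl⟩)
  exact bef_idxOf ((h.perm n σ).nodup_iff.2 (word_nodup σ)) (hm _) (hm _)

theorem GoodW.foldl (ops : List (List ℕ → List ℕ)) :
    ∀ w, GoodW w → (∀ op ∈ ops, op = stackSort ∨ op = bubbleSort ∨ op = queueSort) →
      GoodW (fun n σ => ops.foldl (fun w f => f w) (w n σ)) := by
  induction ops with
  | nil => intro w hw _; exact hw
  | cons f ops ih =>
    intro w hw h
    exact ih _ (hw.op (h f (by simp))) (fun op hop => h op (by simp [hop]))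

theorem word_one (n : ℕ) : word (1 : Equiv.Perm (Fin n)) = List.range n := by
  apply List.ext_getElem <;> simp [word]

theorem word_perm {n : ℕ} (σ : Equiv.Perm (Fin n)) : (word σ).Perm (List.range n) := by
  rw [List.perm_ext_iff_of_nodup (word_nodup σ) List.nodup_range]
  intro a
  rw [mem_word, List.mem_range]
  constructor
  · rintro ⟨i, rfl⟩; exact (σ i).2
  · intro h; exact ⟨σ.symm ⟨a, h⟩, by simp⟩

theorem GoodW.eq_one {w} (hw : GoodW w) :
    TOTODef {p : Perms | w p.1 p.2 = _root_.word (1 : Equiv.Perm (Fin p.1))} := by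
  have : D Empty (fun n σ _ => ∀ i : Fin n, ∀ j : Fin n, bef (w n σ) (σ i) (σ j) → σ i < σ j) :=
    D.all (D.all ((hw.dfn _ _ _).imp' (D.ltV (Sum.inl (Sum.inr ())) _)))
  obtain ⟨φ, hφ⟩ := this
  refine ⟨φ, fun n σ => ?_⟩
  refine (hφ n σ default).symm.trans ?_
  show _ ↔ w n σ = _root_.word 1
  rw [word_one]
  have hp := (hw.perm n σ).trans (word_perm σ)
  constructor
  · intro h
    refine List.Perm.eq_of_pairwise (le := (· < ·)) (fun a b _ _ h1 h2 => absurd h1 h2.asymm) ?_ List.pairwise_lt_range hp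
    rw [pairwise_bef]
    intro x y hxy
    obtain ⟨⟨i, rfl⟩, j, rfl⟩ := hw.bef_mem σ hxy
    exact h i j hxy
  · intro h i j hij
    rw [h] at hij
    exact pairwise_bef.1 List.pairwise_lt_range _ _ hij

theorem bubble_queue_TOTO_definable :
    ListOpTOTODef bubbleSort ∧ ListOpTOTODef queueSort ∧
      ∀ ops : List (List ℕ → List ℕ),
        (∀ op ∈ ops, op = stackSort ∨ op = bubbleSort ∨ op = queueSort) →
        TOTODef {p : Perms |
          ops.foldl (fun w f => f w) (word p.2) = word (1 : Equiv.Perm (Fin p.1))} := by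
  refine ⟨(GoodW.word.op (by simp)).toDef, (GoodW.word.op (by simp)).toDef, fun ops h => ?_⟩
  exact (GoodW.foldl ops _ GoodW.word h).eq_one
end
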